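/- arXiv:1810.02024 — 2 statements merged into one kernel-verified Lean document; each statement's English description precedes it below -/
import Mathlib

section
/- Consider f(x, y) = −x y e^{−x²−y²} + (1/2) y², the feasible set K = {(x, y) ∈ ℝ² : x + y ≤ 0}, and the projected gradient descent map T(p) = P_K(p − ᾱ∇f(p)) with step size 0 < ᾱ < 2/3. If x ≥ 0, then T(x, −x) = (x⁺, −x⁺) where x⁺ = x·(1 − ᾱ/2 − ᾱ(1 − 2x²) e^{−2x²}), and moreover 0 ≤ x⁺ ≤ x. In particular, the half-line {(x, −x) : x ≥ 0} is invariant under T, and the first coordinate is nonincreasing along it. -/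
/-- The objective `f(x, y) = −x y e^{−x²−y²} + (1/2) y²`. -/
noncomputable def fObj (p : ℝ × ℝ) : ℝ :=
  -(p.1 * p.2) * Real.exp (-p.1 ^ 2 - p.2 ^ 2) + p.2 ^ 2 / 2

/-- The gradient `∇f(x, y)` of the objective `fObj`. -/
noncomputable def gradF (p : ℝ × ℝ) : ℝ × ℝ :=
  (-(1 - 2 * p.1 ^ 2) * p.2 * Real.exp (-p.1 ^ 2 - p.2 ^ 2),
   -(1 - 2 * p.2 ^ 2) * p.1 * Real.exp (-p.1 ^ 2 - p.2 ^ 2) + p.2)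

/-- Euclidean metric projection onto the half-plane `K = {(x, y) : x + y ≤ 0}`. -/
noncomputable def projK (q : ℝ × ℝ) : ℝ × ℝ :=
  if q.1 + q.2 ≤ 0 then q else (q.1 - (q.1 + q.2) / 2, q.2 - (q.1 + q.2) / 2)

/-- One step of projected gradient descent with step size `a`: `T(p) = P_K(p − a ∇f(p))`. -/
noncomputable def Tmap (a : ℝ) (p : ℝ × ℝ) : ℝ × ℝ :=
  projK (p - a • gradF p)

theorem stmt_8 (a : ℝ) (ha0 : 0 < a) (ha : a < 2 / 3) (x : ℝ) (hx : 0 ≤ x) :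
    Tmap a (x, -x) =
      (x * (1 - a / 2 - a * (1 - 2 * x ^ 2) * Real.exp (-2 * x ^ 2)),
       -(x * (1 - a / 2 - a * (1 - 2 * x ^ 2) * Real.exp (-2 * x ^ 2)))) ∧
    0 ≤ x * (1 - a / 2 - a * (1 - 2 * x ^ 2) * Real.exp (-2 * x ^ 2)) ∧
    x * (1 - a / 2 - a * (1 - 2 * x ^ 2) * Real.exp (-2 * x ^ 2)) ≤ x := by
  have hE0 : 0 < Real.exp (-2 * x ^ 2) := Real.exp_pos _
  have hE1 : Real.exp (-2 * x ^ 2) ≤ 1 := Real.exp_le_one_iff.2 (by nlinarith [sq_nonneg x])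
  have hF : 1 + 2 * x ^ 2 + (2 * x ^ 2) ^ 2 / 2 ≤ Real.exp (2 * x ^ 2) :=
    Real.quadratic_le_exp_of_nonneg (by positivity)
  have hEF : Real.exp (-2 * x ^ 2) * Real.exp (2 * x ^ 2) = 1 := by
    rw [← Real.exp_add]; ring_nf; simp
  have hexp : -x ^ 2 - (-x) ^ 2 = -2 * x ^ 2 := by ring
  have hT : Tmap a (x, -x) =
      (x * (1 - a / 2 - a * (1 - 2 * x ^ 2) * Real.exp (-2 * x ^ 2)),
       -(x * (1 - a / 2 - a * (1 - 2 * x ^ 2) * Real.exp (-2 * x ^ 2)))) := by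
    simp only [Tmap, projK, gradF, hexp, Prod.fst_sub, Prod.snd_sub, Prod.smul_fst,
      Prod.smul_snd, smul_eq_mul]
    split_ifs with h
    · have h1 : a * x ≤ 0 := by
        ring_nf at h ⊢
        linarith
      have h2 : x = 0 := le_antisymm (by by_contra! hc; nlinarith [mul_pos ha0 hc]) hx
      subst h2
      ext <;> simp
    · ext <;> simp only <;> ring
  refine ⟨hT, ?_, ?_⟩
  · generalize Real.exp (-2 * x ^ 2) = E at *
    have hg : (1 - 2 * x ^ 2) * E ≤ 1 := by nlinarith [mul_nonneg (sq_nonneg x) hE0.le]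
    apply mul_nonneg hx
    nlinarith [mul_le_mul_of_nonneg_left hg ha0.le]
  · have hg : 0 ≤ 1 / 2 + (1 - 2 * x ^ 2) * Real.exp (-2 * x ^ 2) := by
      have h3 : 0 ≤ Real.exp (-2 * x ^ 2) * (Real.exp (2 * x ^ 2) / 2 + (1 - 2 * x ^ 2)) := by
        apply mul_nonneg hE0.le
        nlinarith [sq_nonneg (2 * x ^ 2 - 1)]
      nlinarith
    apply mul_le_of_le_one_right hx
    nlinarith [mul_nonneg ha0.le hg]
end

section
/- For any step size ᾱ with 0 < ᾱ < 2/3 and any x₀ ≥ 0, the sequence defined by x_{k+1} = x_k·(1 − ᾱ/2 − ᾱ(1 − 2x_k²) e^{−2x_k²}) satisfies 0 ≤ x_{k+1} ≤ x_k for all k and converges to 0. -/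
theorem g_bounds (t : ℝ) (ht : 0 ≤ t) :
    (1 - t) * Real.exp (-t) ≤ 1 ∧ -(1 / 4) ≤ (1 - t) * Real.exp (-t) := by
  have hp := Real.exp_pos (-t)
  have h1 : Real.exp (-t) ≤ 1 := Real.exp_le_one_iff.mpr (by linarith)
  refine ⟨by nlinarith, ?_⟩
  have h2 := Real.add_one_le_exp (t - 2)
  have h3 : Real.exp (t - 2) * Real.exp (-t) = Real.exp (-1) * Real.exp (-1) := by
    rw [← Real.exp_add, ← Real.exp_add]; congr 1; ring
  have h4 : Real.exp (-1) ≤ 1 / 2 := by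
    have h5 := Real.add_one_le_exp (1 : ℝ)
    have h6 : Real.exp (-1) * Real.exp 1 = 1 := by
      rw [← Real.exp_add]; simp
    nlinarith [Real.exp_pos (-1)]
  have h7 : (t - 2 + 1) * Real.exp (-t) ≤ Real.exp (t - 2) * Real.exp (-t) :=
    mul_le_mul_of_nonneg_right h2 hp.le
  nlinarith [Real.exp_pos (-1)]

theorem stmt_9 (a : ℝ) (ha0 : 0 < a) (ha : a < 2 / 3) (x : ℕ → ℝ) (hx0 : 0 ≤ x 0)
    (hrec : ∀ k, x (k + 1) =
      x k * (1 - a / 2 - a * (1 - 2 * x k ^ 2) * Real.exp (-2 * x k ^ 2))) :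
    (∀ k, 0 ≤ x (k + 1) ∧ x (k + 1) ≤ x k) ∧
      Filter.Tendsto x Filter.atTop (nhds 0) := by
  have key : ∀ k, 0 ≤ 1 - a / 2 - a * (1 - 2 * x k ^ 2) * Real.exp (-2 * x k ^ 2) ∧
      1 - a / 2 - a * (1 - 2 * x k ^ 2) * Real.exp (-2 * x k ^ 2) ≤ 1 - a / 4 := by
    intro k
    obtain ⟨h1, h2⟩ := g_bounds (2 * x k ^ 2) (by positivity)
    rw [← neg_mul] at h1 h2
    rw [mul_assoc]
    constructor <;> nlinarith
  have hn : ∀ k, 0 ≤ x k := by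
    intro k
    induction k with
    | zero => exact hx0
    | succ k ih => rw [hrec]; exact mul_nonneg ih (key k).1
  have hle : ∀ k, x (k + 1) ≤ x k * (1 - a / 4) := by
    intro k
    rw [hrec]
    exact mul_le_mul_of_nonneg_left (key k).2 (hn k)
  refine ⟨fun k => ⟨hn _, by nlinarith [hle k, hn k]⟩, ?_⟩
  have hb : ∀ k, x k ≤ x 0 * (1 - a / 4) ^ k := by
    intro k
    induction k with
    | zero => simp
    | succ k ih =>
      calc x (k + 1) ≤ x k * (1 - a / 4) := hle k
        _ ≤ x 0 * (1 - a / 4) ^ k * (1 - a / 4) :=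
          mul_le_mul_of_nonneg_right ih (by linarith)
        _ = x 0 * (1 - a / 4) ^ (k + 1) := by ring
  have ht : Filter.Tendsto (fun k : ℕ => x 0 * (1 - a / 4) ^ k) Filter.atTop (nhds 0) := by
    simpa using (tendsto_pow_atTop_nhds_zero_of_lt_one (r := 1 - a / 4) (by linarith)
      (by linarith)).const_mul (x 0)
  exact squeeze_zero hn hb ht
end
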